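/- arXiv:2509.01045 — 2 statements merged into one kernel-verified Lean document; each statement's English description precedes it below -/
import Mathlib

section
/- Let R be a commutative ring and S a regular multiplicative subset of R such that the localization R_S is a semisimple ring. Then every S-h-divisible R-module M admits an S-strongly flat cover: there exists an R-module homomorphism f : F → M with F S-strongly flat such that every homomorphism g : G → M with G S-strongly flat factors through f, and every endomorphism h of F with f ∘ h = f is an automorphism of F. -/
/-- `Ext¹_R(A, B) = 0`, phrased via the standard characterization:
every short exact sequence `0 → B → X → A → 0` of `R`-modules splits. -/
def Ext1Vanishes (R : Type) [CommRing R] (A : Type) [AddCommGroup A] [Module R A]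
    (B : Type) [AddCommGroup B] [Module R B] : Prop :=
  ∀ (X : Type) [AddCommGroup X] [Module R X] (i : B →ₗ[R] X) (p : X →ₗ[R] A),
    Function.Injective i → Function.Surjective p → LinearMap.range i = LinearMap.ker p →
      ∃ s : A →ₗ[R] X, p ∘ₗ s = LinearMap.id

/-- An `R`-module `N` is `S`-weakly cotorsion if `Ext¹_R(R_S, N) = 0`. -/
def SWeaklyCotorsion (R : Type) [CommRing R] (S : Submonoid R)
    (N : Type) [AddCommGroup N] [Module R N] : Prop :=
  Ext1Vanishes R (Localization S) N

/-- An `R`-module `F` is `S`-strongly flat if `Ext¹_R(F, N) = 0` for every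
`S`-weakly cotorsion `R`-module `N`. -/
def SStronglyFlat (R : Type) [CommRing R] (S : Submonoid R)
    (F : Type) [AddCommGroup F] [Module R F] : Prop :=
  ∀ (N : Type) [AddCommGroup N] [Module R N], SWeaklyCotorsion R S N → Ext1Vanishes R F N

/-- An `R`-module `M` is `S`-divisible if `sM = M` for every `s ∈ S`. -/
def SDivisible (R : Type) [CommRing R] (S : Submonoid R)
    (M : Type) [AddCommGroup M] [Module R M] : Prop :=
  ∀ s ∈ S, ∀ m : M, ∃ n : M, s • n = m

/-- An `R`-module `M` is `S`-`h`-divisible if `M` is the sum of the images of all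
`R`-linear maps `R_S → M`. -/
def SHDivisible (R : Type) [CommRing R] (S : Submonoid R)
    (M : Type) [AddCommGroup M] [Module R M] : Prop :=
  (⨆ f : Localization S →ₗ[R] M, LinearMap.range f) = ⊤

/-- An `R`-module `M` is `S`-injective if for every ideal `I` of `R` meeting `S`, every
`R`-linear map `I → M` extends to `R` (equivalently, `Ext¹_R(R/I, M) = 0` for such `I`). -/
def SInjective (R : Type) [CommRing R] (S : Submonoid R)
    (M : Type) [AddCommGroup M] [Module R M] : Prop :=
  ∀ I : Ideal R, ((I : Set R) ∩ (S : Set R)).Nonempty →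
    ∀ f : I →ₗ[R] M, ∃ g : R →ₗ[R] M, ∀ x : I, g (x : R) = f x

/-- An `R`-module `T` is `S`-torsion if each of its elements is annihilated by some `s ∈ S`. -/
def STorsion (R : Type) [CommRing R] (S : Submonoid R)
    (T : Type) [AddCommGroup T] [Module R T] : Prop :=
  ∀ t : T, ∃ s ∈ S, s • t = 0

/-- Coextension of scalars: `Hom_R(R_S, M)` as an `R_S`-module. -/
noncomputable abbrev coextendedModule (R : Type*) [CommRing R] (S : Submonoid R)
    (M : Type*) [AddCommGroup M] [Module R M] :
    Module (Localization S) (Localization S →ₗ[R] M) where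
  smul q φ := φ ∘ₗ LinearMap.mulLeft R q
  one_smul φ := LinearMap.ext fun x => congrArg φ (one_mul x)
  mul_smul a b φ := LinearMap.ext fun x =>
    congrArg φ (show a * b * x = b * (a * x) by ring)
  smul_zero _ := rfl
  smul_add _ _ _ := rfl
  add_smul a b φ := LinearMap.ext fun x =>
    (congrArg φ (add_mul a b x)).trans (map_add φ _ _)
  zero_smul φ := LinearMap.ext fun x =>
    (congrArg φ (zero_mul x)).trans (map_zero φ)

attribute [local instance] coextendedModule

theorem coextendedModule_smul_apply {R : Type*} [CommRing R] {S : Submonoid R}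
    {M : Type*} [AddCommGroup M] [Module R M] (q x : Localization S)
    (φ : Localization S →ₗ[R] M) : (q • φ) x = φ (q * x) := rfl

theorem coextendedModule_isScalarTower (R : Type*) [CommRing R] (S : Submonoid R)
    (M : Type*) [AddCommGroup M] [Module R M] :
    IsScalarTower R (Localization S) (Localization S →ₗ[R] M) where
  smul_assoc r q φ := LinearMap.ext fun x => by
    rw [coextendedModule_smul_apply, smul_mul_assoc, map_smul, LinearMap.smul_apply,
      coextendedModule_smul_apply]

attribute [local instance] coextendedModule_isScalarTower

/-- If `Ext¹(G, ker p) = 0`, then every map from `G` lifts along the surjection `p`. -/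
theorem Ext1Vanishes.exists_lift {R : Type} [CommRing R]
    {G N X C : Type} [AddCommGroup G] [Module R G] [AddCommGroup N] [Module R N]
    [AddCommGroup X] [Module R X] [AddCommGroup C] [Module R C]
    (h : Ext1Vanishes R G N) (i : N →ₗ[R] X) (p : X →ₗ[R] C)
    (hi : Function.Injective i) (hp : Function.Surjective p)
    (hip : LinearMap.range i = LinearMap.ker p) (g : G →ₗ[R] C) :
    ∃ g' : G →ₗ[R] X, p ∘ₗ g' = g := by
  let P : Submodule R (X × G) :=
    LinearMap.eqLocus (p ∘ₗ LinearMap.fst R X G) (g ∘ₗ LinearMap.snd R X G)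
  have hpi : ∀ n, p (i n) = 0 := fun n =>
    LinearMap.mem_ker.1 (hip ▸ LinearMap.mem_range_self i n)
  let j : N →ₗ[R] P := (LinearMap.inl R X G ∘ₗ i).codRestrict P fun n => by
    simp [P, LinearMap.mem_eqLocus, hpi]
  obtain ⟨s, hs⟩ := h P j (LinearMap.snd R X G ∘ₗ P.subtype)
    (fun a b hab => hi (congrArg (fun z : P => z.1.1) hab))
    (fun y => by
      obtain ⟨x, hx⟩ := hp (g y)
      exact ⟨⟨(x, y), hx⟩, rfl⟩)
    (by
      ext ⟨⟨x, y⟩, hxy⟩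
      constructor
      · rintro ⟨n, hn⟩
        exact (congrArg (fun z : P => z.1.2) hn).symm
      · intro hy
        have hy : y = 0 := hy
        have hx : x ∈ LinearMap.ker p := by
          have hxy : p x = g y := hxy
          rw [LinearMap.mem_ker, hxy, hy, map_zero]
        rw [← hip] at hx
        obtain ⟨n, rfl⟩ := hx
        exact ⟨n, Subtype.ext (Prod.ext rfl hy.symm)⟩)
  refine ⟨LinearMap.fst R X G ∘ₗ P.subtype ∘ₗ s, LinearMap.ext fun y => ?_⟩
  have hy : (s y).1.2 = y := LinearMap.congr_fun hs y
  exact (s y).2.trans (congrArg g hy)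

/-- A projective `R_S`-module is `S`-strongly flat. -/
theorem sStronglyFlat_of_projective {R : Type} [CommRing R] (S : Submonoid R)
    (V : Type) [AddCommGroup V] [Module R V] [Module (Localization S) V]
    [IsScalarTower R (Localization S) V] [Module.Projective (Localization S) V] :
    SStronglyFlat R S V := by
  intro N _ _ hN X _ _ i p hi hp hip
  obtain ⟨t, ht⟩ := Module.Projective.out (R := Localization S) (P := V)
  choose l hl using fun v : V => Ext1Vanishes.exists_lift hN i p hi hp hip
    ((LinearMap.toSpanSingleton (Localization S) V v).restrictScalars R)
  refine ⟨Finsupp.lsum R l ∘ₗ t.restrictScalars R, LinearMap.ext fun v => ?_⟩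
  have hsum : p ∘ₗ Finsupp.lsum R l =
      (Finsupp.linearCombination (Localization S) (id : V → V)).restrictScalars R := by
    refine Finsupp.lhom_ext fun w q => ?_
    simpa using LinearMap.congr_fun (hl w) q
  exact (LinearMap.congr_fun hsum (t v)).trans (ht v)

/-- A map to an injective `R_S`-module extends along every injective `R`-linear map. -/
theorem exists_extend_of_injective_localization {R : Type} [CommRing R] (S : Submonoid R)
    {N X V : Type} [AddCommGroup N] [Module R N] [AddCommGroup X] [Module R X]
    [AddCommGroup V] [Module R V] [Module (Localization S) V]
    [IsScalarTower R (Localization S) V] [Module.Injective (Localization S) V]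
    (i : N →ₗ[R] X) (hi : Function.Injective i) (j : N →ₗ[R] V) :
    ∃ r : X →ₗ[R] V, r ∘ₗ i = j := by
  have hunit : ∀ s : S, IsUnit (algebraMap R (Module.End R V) s) := fun s => by
    rw [← (Algebra.lsmul R (A := Localization S) R V).commutes]
    exact (IsLocalization.map_units (Localization S) s).map _
  let j' := IsLocalizedModule.lift S (LocalizedModule.mkLinearMap S N) j hunit
  obtain ⟨k, hk⟩ := Module.Injective.out (R := Localization S) (LocalizedModule.map S i)
    (LocalizedModule.map_injective S i hi)
    (j'.extendScalarsOfIsLocalization S (Localization S))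
  refine ⟨k.restrictScalars R ∘ₗ LocalizedModule.mkLinearMap S X, LinearMap.ext fun n => ?_⟩
  have h := hk (LocalizedModule.mkLinearMap S N n)
  simp only [LocalizedModule.mkLinearMap_apply, LocalizedModule.map_mk] at h
  refine h.trans ?_
  exact IsLocalizedModule.lift_apply S (LocalizedModule.mkLinearMap S N) j hunit n

/-- A linear map vanishing on the kernel of a surjection factors through it. -/
theorem exists_comp_eq_of_ker_le_ker {R X C Y : Type*} [Ring R] [AddCommGroup X] [Module R X]
    [AddCommGroup C] [Module R C] [AddCommGroup Y] [Module R Y] {p : X →ₗ[R] C}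
    (hp : Function.Surjective p) {f : X →ₗ[R] Y} (h : LinearMap.ker p ≤ LinearMap.ker f) :
    ∃ g : C →ₗ[R] Y, g ∘ₗ p = f := by
  refine ⟨(LinearMap.ker p).liftQ f h ∘ₗ (p.quotKerEquivOfSurjective hp).symm.toLinearMap,
    LinearMap.ext fun x => ?_⟩
  have hx : (p.quotKerEquivOfSurjective hp).symm (p x) = (LinearMap.ker p).mkQ x := by
    rw [LinearEquiv.symm_apply_eq]
    rfl
  simp [hx]

/-- Evaluation at `1` on `Hom_R(R_S, M)`. -/
noncomputable abbrev evalOne (R : Type*) [CommRing R] (S : Submonoid R)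
    (M : Type*) [AddCommGroup M] [Module R M] : (Localization S →ₗ[R] M) →ₗ[R] M :=
  LinearMap.applyₗ 1

/-- The kernel of evaluation at `1` on `Hom_R(R_S, M)` is `S`-weakly cotorsion. -/
theorem sWeaklyCotorsion_ker_evalOne {R : Type} [CommRing R] (S : Submonoid R)
    [IsSemisimpleRing (Localization S)] (M : Type) [AddCommGroup M] [Module R M] :
    SWeaklyCotorsion R S (LinearMap.ker (evalOne R S M)) := by
  intro X _ _ i p hi hp hip
  have : Module.Injective (Localization S) (Localization S →ₗ[R] M) :=
    Module.injective_of_isSemisimpleRing _ _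
  obtain ⟨r, hr⟩ := exists_extend_of_injective_localization S i hi
    (LinearMap.ker (evalOne R S M)).subtype
  have hr' : ∀ n, r (i n) = n := LinearMap.congr_fun hr
  have hker : LinearMap.ker p ≤ LinearMap.ker (evalOne R S M ∘ₗ r) := by
    rw [← hip]
    rintro _ ⟨n, rfl⟩
    rw [LinearMap.mem_ker, LinearMap.comp_apply, hr']
    exact n.2
  obtain ⟨ψ, hψ⟩ : ∃ ψ : Localization S →ₗ[R] M, ψ ∘ₗ p = evalOne R S M ∘ₗ r :=
    exists_comp_eq_of_ker_le_ker hp hker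
  -- Correct `r` by a multiple of `ψ` to a retraction `ρ` of `X` onto the kernel.
  let ρ : X →ₗ[R] LinearMap.ker (evalOne R S M) :=
    (r - (LinearMap.toSpanSingleton (Localization S) _ ψ).restrictScalars R ∘ₗ p).codRestrict _
      fun x => by
        have h : ψ (p x) = r x 1 := LinearMap.congr_fun hψ x
        simp [coextendedModule_smul_apply, h]
  have hpi : ∀ n, p (i n) = 0 := fun n =>
    LinearMap.mem_ker.1 (hip ▸ LinearMap.mem_range_self i n)
  have hρ : ∀ n, ρ (i n) = n := fun n => Subtype.ext <| by simp [ρ, hr', hpi]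
  have hker' : LinearMap.ker p ≤ LinearMap.ker (LinearMap.id - i ∘ₗ ρ) := by
    rw [← hip]
    rintro _ ⟨n, rfl⟩
    simp [hρ]
  obtain ⟨σ, hσ⟩ := exists_comp_eq_of_ker_le_ker hp hker'
  refine ⟨σ, LinearMap.ext fun q => ?_⟩
  obtain ⟨x, rfl⟩ := hp q
  have h : σ (p x) = x - i (ρ x) := LinearMap.congr_fun hσ x
  simp [h, hpi]

/-- If `M` is `S`-`h`-divisible, then evaluation at `1` maps `Hom_R(R_S, M)` onto `M`. -/
theorem SHDivisible.evalOne_surjective {R : Type} [CommRing R] {S : Submonoid R}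
    {M : Type} [AddCommGroup M] [Module R M] (hM : SHDivisible R S M) :
    Function.Surjective (evalOne R S M) := by
  rw [← LinearMap.range_eq_top, eq_top_iff, ← hM]
  refine iSup_le fun φ => ?_
  rintro _ ⟨q, rfl⟩
  exact ⟨q • φ, congrArg φ (mul_one q)⟩

/-- Evaluation at `1` on `Hom_R(R_S, M)` is right minimal: only the identity preserves it. -/
theorem eq_id_of_evalOne_comp {R : Type*} [CommRing R] {S : Submonoid R}
    {M : Type*} [AddCommGroup M] [Module R M]
    (h : (Localization S →ₗ[R] M) →ₗ[R] (Localization S →ₗ[R] M))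
    (hh : evalOne R S M ∘ₗ h = evalOne R S M) : h = LinearMap.id := by
  refine LinearMap.ext fun φ => LinearMap.ext fun q => ?_
  have hq : h (q • φ) 1 = (q • φ) 1 := LinearMap.congr_fun hh (q • φ)
  have hlin : h (q • φ) = q • h φ :=
    (h.extendScalarsOfIsLocalization S (Localization S)).map_smul q φ
  rwa [hlin, coextendedModule_smul_apply, coextendedModule_smul_apply, mul_one] at hq

/-- If `S` is a regular multiplicative subset of `R` such that `R_S` is semisimple, then
every `S`-`h`-divisible `R`-module admits an `S`-strongly flat cover. -/
theorem sHDivisible_has_sStronglyFlat_cover (R : Type) [CommRing R] (S : Submonoid R)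
    (hreg : S ≤ nonZeroDivisors R) [IsSemisimpleRing (Localization S)]
    (M : Type) [AddCommGroup M] [Module R M] (hM : SHDivisible R S M) :
    ∃ (F : Type) (_ : AddCommGroup F) (_ : Module R F) (f : F →ₗ[R] M),
      SStronglyFlat R S F ∧
      (∀ (G : Type) [AddCommGroup G] [Module R G], SStronglyFlat R S G →
        ∀ g : G →ₗ[R] M, ∃ g' : G →ₗ[R] F, f ∘ₗ g' = g) ∧
      (∀ h : F →ₗ[R] F, f ∘ₗ h = f → Function.Bijective h) := by
  have : Module.Projective (Localization S) (Localization S →ₗ[R] M) :=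
    Module.projective_of_isSemisimpleRing _ _
  refine ⟨Localization S →ₗ[R] M, inferInstance, inferInstance,
    evalOne R S M, sStronglyFlat_of_projective S _, ?_, ?_⟩
  · intro G _ _ hG g
    exact (hG _ (sWeaklyCotorsion_ker_evalOne S M)).exists_lift _ _
      (Submodule.injective_subtype _) hM.evalOne_surjective (Submodule.range_subtype _) g
  · intro h hh
    rw [eq_id_of_evalOne_comp h hh]
    exact Function.bijective_id
end

section
/- Let R be a commutative ring and S a regular multiplicative subset of R. If every S-divisible R-module admits an S-strongly flat cover, then R is an S-Matlis ring, i.e., the projective dimension of R_S as an R-module is at most 1. -/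
/-- `R` is an `S`-Matlis ring: the projective dimension of `R_S` as an `R`-module is at
most `1`, i.e. `R_S` is the quotient of a projective `R`-module by a projective submodule. -/
def SMatlis (R : Type) [CommRing R] (S : Submonoid R) : Prop :=
  ∃ (P : Type) (_ : AddCommGroup P) (_ : Module R P) (f : P →ₗ[R] Localization S),
    Module.Projective R P ∧ Function.Surjective f ∧ Module.Projective R (LinearMap.ker f)

section Auxiliary

variable {R : Type} [CommRing R] {S : Submonoid R}

/-- Maps along `f` extend when the first `Ext` group of the cokernel vanishes. -/
theorem Ext1Vanishes.exists_extension {P A B : Type} [AddCommGroup P] [Module R P]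
    [AddCommGroup A] [Module R A] [AddCommGroup B] [Module R B]
    (hAB : Ext1Vanishes R A B) (f : P →ₗ[R] A) (hf : Function.Surjective f)
    (g : LinearMap.ker f →ₗ[R] B) :
    ∃ g' : P →ₗ[R] B, ∀ k : LinearMap.ker f, g' k = g k := by
  let W : Submodule R (B × P) := LinearMap.range (g.prod (-(LinearMap.ker f).subtype))
  let i : B →ₗ[R] (B × P) ⧸ W := W.mkQ ∘ₗ LinearMap.inl R B P
  let j : P →ₗ[R] (B × P) ⧸ W := W.mkQ ∘ₗ LinearMap.inr R B P
  let p : (B × P) ⧸ W →ₗ[R] A := W.liftQ (f ∘ₗ LinearMap.snd R B P) (by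
    rintro _ ⟨k, rfl⟩
    simp)
  have hj : ∀ k : LinearMap.ker f, j k = i (g k) := by
    intro k
    symm
    refine (Submodule.Quotient.eq W).2 ⟨k, ?_⟩
    simp
  have hpj : ∀ x, p (j x) = f x := fun x => by simp [p, j]
  have hpi : ∀ b, p (i b) = 0 := fun b => by simp [p, i]
  have hi : Function.Injective i := by
    rw [injective_iff_map_eq_zero]
    intro b hb
    obtain ⟨k, hk⟩ := (Submodule.Quotient.mk_eq_zero W).1 hb
    have h2 : k = 0 := by
      have := congrArg Prod.snd hk
      simpa using this
    have h1 := congrArg Prod.fst hk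
    simpa [h2] using h1.symm
  have hexact : LinearMap.range i = LinearMap.ker p := by
    apply le_antisymm
    · rintro _ ⟨b, rfl⟩
      exact hpi b
    · intro x hx
      obtain ⟨⟨b, y⟩, rfl⟩ := W.mkQ_surjective x
      have hy : f y = 0 := by simpa [p] using hx
      refine ⟨b + g ⟨y, hy⟩, ?_⟩
      rw [map_add, ← hj ⟨y, hy⟩]
      simp only [i, j, LinearMap.comp_apply, ← map_add]
      simp
  obtain ⟨s, hs⟩ := hAB _ i p hi (fun a => (hf a).imp' j fun y hy => (hpj y).trans hy) hexact
  have hps : ∀ a, p (s a) = a := fun a => LinearMap.congr_fun hs a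
  let d : P →ₗ[R] LinearMap.range i := (j - s ∘ₗ f).codRestrict _ (fun y => by
    rw [hexact]
    simp [hpj, hps])
  refine ⟨(LinearEquiv.ofInjective i hi).symm.toLinearMap ∘ₗ d, fun k => ?_⟩
  rw [LinearMap.comp_apply, LinearEquiv.coe_coe, LinearEquiv.symm_apply_eq]
  apply Subtype.ext
  simp [d, hj]

/-- Maps out of `A` lift along `q` when the first `Ext` group with values in the kernel
vanishes. -/
theorem Ext1Vanishes.exists_lift_s13 {A M N : Type} [AddCommGroup A] [Module R A]
    [AddCommGroup M] [Module R M] [AddCommGroup N] [Module R N] (q : M →ₗ[R] N)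
    (hA : Ext1Vanishes R A (LinearMap.ker q)) (hq : Function.Surjective q) (f : A →ₗ[R] N) :
    ∃ g : A →ₗ[R] M, q ∘ₗ g = f := by
  let X : Submodule R (A × M) :=
    LinearMap.eqLocus (f ∘ₗ LinearMap.fst R A M) (q ∘ₗ LinearMap.snd R A M)
  let i : LinearMap.ker q →ₗ[R] X :=
    (LinearMap.inr R A M ∘ₗ (LinearMap.ker q).subtype).codRestrict X (fun k => by simp [X])
  let p : X →ₗ[R] A := LinearMap.fst R A M ∘ₗ X.subtype
  obtain ⟨s, hs⟩ := hA X i p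
    (fun a b hab => Subtype.ext (congrArg (fun x : X => x.1.2) hab))
    (fun a => by
      obtain ⟨m, hm⟩ := hq (f a)
      exact ⟨⟨(a, m), hm.symm⟩, rfl⟩)
    (by
      ext ⟨⟨a, m⟩, hx⟩
      have hx' : f a = q m := hx
      constructor
      · rintro ⟨k, hk⟩
        exact (congrArg (fun x : X => x.1.1) hk).symm
      · intro ha
        have ha' : a = 0 := ha
        subst ha'
        exact ⟨⟨m, by simpa using hx'.symm⟩, rfl⟩)
  refine ⟨LinearMap.snd R A M ∘ₗ X.subtype ∘ₗ s, LinearMap.ext fun a => ?_⟩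
  have h1 : (s a).1.1 = a := LinearMap.congr_fun hs a
  have h2 : f (s a).1.1 = q (s a).1.2 := (s a).2
  rw [h1] at h2
  exact h2.symm

/-- A module killed by an element of `S` is `S`-weakly cotorsion. -/
theorem SWeaklyCotorsion.of_smul_eq_zero {N : Type} [AddCommGroup N] [Module R N]
    {s : R} (hs : s ∈ S) (hN : ∀ n : N, s • n = 0) : SWeaklyCotorsion R S N := by
  intro X _ _ i p _ hp hexact
  let e := p.quotKerEquivOfSurjective hp
  let φ : (X ⧸ LinearMap.ker p) →ₗ[R] X :=
    (LinearMap.ker p).liftQ (LinearMap.lsmul R X s) (by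
      rw [← hexact]
      rintro _ ⟨n, rfl⟩
      simp [← map_smul, hN])
  let u : Localization S := IsLocalization.mk' (Localization S) 1 (⟨s, hs⟩ : S)
  refine ⟨φ ∘ₗ e.symm.toLinearMap ∘ₗ (LinearMap.mulLeft R u), LinearMap.ext fun a => ?_⟩
  obtain ⟨x, hx⟩ := hp (u * a)
  have hex : e.symm (u * a) = Submodule.Quotient.mk x := by
    rw [LinearEquiv.symm_apply_eq, ← hx]
    rfl
  have hu : algebraMap R (Localization S) s * u = 1 := by
    rw [← map_one (algebraMap R (Localization S))]
    exact IsLocalization.mk'_spec' (Localization S) (1 : R) (⟨s, hs⟩ : S)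
  simp only [LinearMap.comp_apply, LinearMap.mulLeft_apply, LinearEquiv.coe_coe, hex, φ,
    Submodule.liftQ_apply, LinearMap.lsmul_apply, map_smul, hx, LinearMap.id_apply]
  rw [Algebra.smul_def, ← mul_assoc, hu, one_mul]

theorem SStronglyFlat.of_projective {P : Type} [AddCommGroup P] [Module R P]
    [Module.Projective R P] : SStronglyFlat R S P :=
  fun _ _ _ _ _ _ _ _ p _ hp _ => Module.projective_lifting_property p LinearMap.id hp

/-- An `S`-divisible module with an `S`-strongly flat cover is the image of a module on which
every element of `S` acts bijectively. -/
theorem SDivisible.exists_surjective_of_cover {M F : Type} [AddCommGroup M] [Module R M]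
    [AddCommGroup F] [Module R F] (hM : SDivisible R S M) (f : F →ₗ[R] M)
    (hF : SStronglyFlat R S F)
    (hpre : ∀ (G : Type) [AddCommGroup G] [Module R G], SStronglyFlat R S G →
      ∀ g : G →ₗ[R] M, ∃ g' : G →ₗ[R] F, f ∘ₗ g' = g)
    (hcov : ∀ h : F →ₗ[R] F, f ∘ₗ h = f → Function.Bijective h) :
    Function.Surjective f ∧ ∀ s ∈ S, Function.Bijective fun x : F => s • x := by
  constructor
  · intro m
    obtain ⟨g, hg⟩ := hpre R SStronglyFlat.of_projective (LinearMap.toSpanSingleton R M m)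
    exact ⟨g 1, by simpa using LinearMap.congr_fun hg 1⟩
  · intro s hs
    have hker : SWeaklyCotorsion R S (LinearMap.ker (LinearMap.lsmul R M s)) :=
      SWeaklyCotorsion.of_smul_eq_zero hs fun n => Subtype.ext n.2
    obtain ⟨g, hg⟩ := (hF _ hker).exists_lift_s13 (LinearMap.lsmul R M s) (hM s hs) f
    obtain ⟨h, hh⟩ := hpre F hF g
    have hb := hcov (s • h) (by rw [LinearMap.comp_smul, hh]; exact hg)
    constructor
    · refine (injective_iff_map_eq_zero (DistribSMul.toAddMonoidHom F s)).2 fun x hx => ?_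
      have hx' : s • x = 0 := hx
      apply hb.1
      rw [LinearMap.smul_apply, ← map_smul, hx', map_zero, map_zero]
    · intro y
      obtain ⟨x, hx⟩ := hb.2 y
      exact ⟨h x, hx⟩

/-- A surjection onto `R_S` from a module on which `S` acts bijectively splits. -/
theorem exists_rightInverse_localization {F : Type} [AddCommGroup F] [Module R F]
    (hF : ∀ s ∈ S, Function.Bijective fun x : F => s • x) (f : F →ₗ[R] Localization S)
    (hf : Function.Surjective f) :
    ∃ g : Localization S →ₗ[R] F, f ∘ₗ g = LinearMap.id := by
  obtain ⟨y, hy⟩ := hf 1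
  let l := Algebra.linearMap R (Localization S)
  have hunit : ∀ x : S, IsUnit ((algebraMap R (Module.End R F)) x) := fun x =>
    (Module.End.isUnit_iff _).2 (hF x x.2)
  refine ⟨IsLocalizedModule.lift S l (LinearMap.toSpanSingleton R F y) hunit, ?_⟩
  refine IsLocalizedModule.ext S l (IsLocalizedModule.map_units l) ?_
  rw [LinearMap.comp_assoc, IsLocalizedModule.lift_comp]
  ext
  simp [hy, l]

theorem SDivisible.of_extension {A X B : Type} [AddCommGroup A] [Module R A]
    [AddCommGroup X] [Module R X] [AddCommGroup B] [Module R B] (hA : SDivisible R S A)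
    (hB : SDivisible R S B) (i : A →ₗ[R] X) (p : X →ₗ[R] B) (hp : Function.Surjective p)
    (hexact : LinearMap.range i = LinearMap.ker p) : SDivisible R S X := by
  intro s hs x
  obtain ⟨b, hb⟩ := hB s hs (p x)
  obtain ⟨y, rfl⟩ := hp b
  have hxy : x - s • y ∈ LinearMap.range i := by
    rw [hexact]
    simp [hb]
  obtain ⟨a, ha⟩ := hxy
  obtain ⟨c, rfl⟩ := hA s hs a
  exact ⟨i c + y, by rw [smul_add, ← map_smul, ha, sub_add_cancel]⟩

theorem SDivisible.of_surjective {A B : Type} [AddCommGroup A] [Module R A]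
    [AddCommGroup B] [Module R B] (hA : SDivisible R S A) (p : A →ₗ[R] B)
    (hp : Function.Surjective p) : SDivisible R S B := by
  intro s hs b
  obtain ⟨a, rfl⟩ := hp b
  obtain ⟨c, rfl⟩ := hA s hs a
  exact ⟨p c, (map_smul p s c).symm⟩

variable (R S) in
theorem SDivisible.localization : SDivisible R S (Localization S) := by
  intro s hs a
  refine ⟨IsLocalization.mk' (Localization S) 1 (⟨s, hs⟩ : S) * a, ?_⟩
  have hu := IsLocalization.mk'_spec' (Localization S) (1 : R) (⟨s, hs⟩ : S)
  rw [Algebra.smul_def, ← mul_assoc, hu, map_one, one_mul]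

theorem SDivisible.of_injective (hreg : S ≤ nonZeroDivisors R) {E : Type} [AddCommGroup E]
    [Module R E] [Module.Injective R E] : SDivisible R S E := by
  intro s hs e
  obtain ⟨h, hh⟩ := Module.Injective.out (LinearMap.mulLeft R s)
    (fun a b hab => by
      exact (mul_cancel_left_mem_nonZeroDivisors (hreg hs)).1 hab)
    (LinearMap.toSpanSingleton R E e)
  refine ⟨h 1, ?_⟩
  rw [← map_smul]
  simpa using hh 1

/-- Projectivity can be tested on surjections out of injective modules. -/
theorem Module.Projective.of_lifting_injective {P : Type} [AddCommGroup P] [Module R P]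
    (hP : ∀ (E : Type) [AddCommGroup E] [Module R E] [Module.Injective R E]
      (N : Submodule R E) (g : P →ₗ[R] E ⧸ N), ∃ g' : P →ₗ[R] E, N.mkQ ∘ₗ g' = g) :
    Module.Projective R P := by
  refine Module.Projective.of_lifting_property'' fun q hq => ?_
  obtain ⟨⟨J, _, i, _⟩⟩ :=
    CategoryTheory.EnoughInjectives.presentation (ModuleCat.of R (P →₀ R))
  let ι : (P →₀ R) →ₗ[R] J := i.hom
  have hι : Function.Injective ι := (ModuleCat.mono_iff_injective i).1 inferInstance
  have : Module.Injective R J := Module.injective_module_of_injective_object R J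
  let N : Submodule R J := (LinearMap.ker q).map ι
  let e := q.quotKerEquivOfSurjective hq
  let m : ((P →₀ R) ⧸ LinearMap.ker q) →ₗ[R] J ⧸ N :=
    (LinearMap.ker q).mapQ N ι (Submodule.le_comap_map _ _)
  have hm : ∀ a, m (e.symm (q a)) = N.mkQ (ι a) := by
    intro a
    have : e.symm (q a) = Submodule.Quotient.mk a := by
      rw [LinearEquiv.symm_apply_eq]
      rfl
    rw [this]
    rfl
  obtain ⟨g', hg'⟩ := hP J N (m ∘ₗ e.symm.toLinearMap)
  have key : ∀ x, ∃ a, ι a = g' x ∧ q a = x := by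
    intro x
    obtain ⟨a, ha⟩ := hq x
    have hx : N.mkQ (g' x) = N.mkQ (ι a) := by
      rw [← hm, ha]
      exact LinearMap.congr_fun hg' x
    obtain ⟨k, hk, hk'⟩ := (Submodule.Quotient.eq N).1 hx
    have hk0 : q k = 0 := hk
    exact ⟨k + a, by rw [map_add, hk', sub_add_cancel], by rw [map_add, hk0, zero_add, ha]⟩
  let e' := LinearEquiv.ofInjective ι hι
  refine ⟨e'.symm.toLinearMap ∘ₗ g'.codRestrict (LinearMap.range ι)
    (fun x => (key x).imp fun _ h => h.1), LinearMap.ext fun x => ?_⟩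
  obtain ⟨a, ha, hqa⟩ := key x
  have : e'.symm (g'.codRestrict (LinearMap.range ι)
      (fun x => (key x).imp fun _ h => h.1) x) = a := by
    rw [LinearEquiv.symm_apply_eq]
    exact Subtype.ext ha.symm
  simp only [LinearMap.comp_apply, LinearEquiv.coe_coe, LinearMap.id_apply]
  rw [this, hqa]

/-- If `S` is regular and all `S`-divisible modules are `S`-weakly cotorsion, then
`pd_R R_S ≤ 1`. -/
theorem SMatlis.of_sDivisible_sWeaklyCotorsion (hreg : S ≤ nonZeroDivisors R)
    (h : ∀ (D : Type) [AddCommGroup D] [Module R D], SDivisible R S D →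
      SWeaklyCotorsion R S D) : SMatlis R S := by
  let f := Finsupp.linearCombination R (id : Localization S → Localization S)
  have hf : Function.Surjective f := Finsupp.linearCombination_id_surjective R _
  refine ⟨Localization S →₀ R, inferInstance, inferInstance, f, inferInstance, hf, ?_⟩
  refine Module.Projective.of_lifting_injective fun E _ _ _ N g => ?_
  have hD : SDivisible R S (E ⧸ N) :=
    (SDivisible.of_injective hreg).of_surjective N.mkQ N.mkQ_surjective
  obtain ⟨g₁, hg₁⟩ := (h _ hD).exists_extension f hf g
  obtain ⟨g₂, hg₂⟩ := Module.projective_lifting_property N.mkQ g₁ N.mkQ_surjective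
  refine ⟨g₂ ∘ₗ (LinearMap.ker f).subtype, LinearMap.ext fun k => ?_⟩
  rw [← hg₁ k, ← hg₂]
  rfl

end Auxiliary

/-- If every `S`-divisible `R`-module admits an `S`-strongly flat cover (`S` a regular
multiplicative subset), then `R` is an `S`-Matlis ring, i.e. `pd_R R_S ≤ 1`. -/
theorem sMatlis_of_sDivisible_covers (R : Type) [CommRing R] (S : Submonoid R)
    (hreg : S ≤ nonZeroDivisors R)
    (hcov : ∀ (M : Type) [AddCommGroup M] [Module R M], SDivisible R S M →
      ∃ (F : Type) (_ : AddCommGroup F) (_ : Module R F) (f : F →ₗ[R] M),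
        SStronglyFlat R S F ∧
        (∀ (G : Type) [AddCommGroup G] [Module R G], SStronglyFlat R S G →
          ∀ g : G →ₗ[R] M, ∃ g' : G →ₗ[R] F, f ∘ₗ g' = g) ∧
        (∀ h : F →ₗ[R] F, f ∘ₗ h = f → Function.Bijective h)) :
    SMatlis R S := by
  refine SMatlis.of_sDivisible_sWeaklyCotorsion hreg fun D _ _ hD => ?_
  intro X _ _ i p _ hp hexact
  have hX : SDivisible R S X :=
    hD.of_extension (SDivisible.localization R S) i p hp hexact
  obtain ⟨F, _, _, f, hF, hpre, hcover⟩ := hcov X hX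
  obtain ⟨hf, hbij⟩ := hX.exists_surjective_of_cover f hF hpre hcover
  obtain ⟨g, hg⟩ := exists_rightInverse_localization hbij (p ∘ₗ f) (hp.comp hf)
  exact ⟨f ∘ₗ g, hg⟩
end
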